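/- arXiv:1411.3005 — 2 statements merged into one kernel-verified Lean document; each statement's English description precedes it below -/
import Mathlib

section
/- There exists a constant c > 0 (depending only on n and on the normalization of μ) such that for every complex number s with Re(s) > n − 1, the function g ↦ exp(−π ‖g‖²) · |det g|^{s} is μ-integrable on GL_n(ℝ) and ∫_{GL_n(ℝ)} exp(−π ‖g‖²) |det g|^{s} dμ(g) = c · ∏_{k=0}^{n−1} π^{−(s−k)/2} Γ((s−k)/2). -/
open MeasureTheory

open Topology

/-- The multiplicative function `x ↦ |x| ^ t` on `ℝ`, with value `0` at `0` for every `t`. -/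
noncomputable def absPow (t : ℂ) (x : ℝ) : ℂ :=
  if x = 0 then 0 else Complex.exp (t * Real.log |x|)

lemma absPow_mul (t : ℂ) (x y : ℝ) : absPow t (x * y) = absPow t x * absPow t y := by
  by_cases hx : x = 0
  · simp [absPow, hx]
  by_cases hy : y = 0
  · simp [absPow, hy]
  simp only [absPow, hx, hy, mul_eq_zero, or_self, if_false, abs_mul]
  rw [Real.log_mul (abs_ne_zero.2 hx) (abs_ne_zero.2 hy), ← Complex.exp_add]
  push_cast
  ring_nf

lemma absPow_of_abs_eq_one (t : ℂ) {x : ℝ} (hx : |x| = 1) : absPow t x = 1 := by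
  have : x ≠ 0 := by rintro rfl; simp at hx
  simp [absPow, this, hx]

lemma absPow_of_pos (t : ℂ) {x : ℝ} (hx : 0 < x) : absPow t x = (x : ℂ) ^ t := by
  rw [absPow, if_neg hx.ne', abs_of_pos hx, Complex.cpow_def_of_ne_zero (by exact_mod_cast hx.ne'),
    Complex.ofReal_log hx.le, mul_comm]

@[fun_prop]
lemma measurable_absPow (t : ℂ) : Measurable (absPow t) :=
  Measurable.ite (measurableSet_singleton 0) measurable_const (by fun_prop)

lemma integral_Ioi_pow_mul_gaussian_absPow (m : ℕ) {t : ℂ} (ht : -(m + 1 : ℝ) < t.re) :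
    ∫ y in Set.Ioi (0 : ℝ), y ^ m • ((Real.exp (-Real.pi * y ^ 2) : ℂ) * absPow t y) =
      (1 / 2) * ((Real.pi : ℂ) ^ (-((t + (m + 1 : ℕ)) / 2)) *
        Complex.Gamma ((t + (m + 1 : ℕ)) / 2)) := by
  set a : ℂ := (t + (m + 1 : ℕ)) / 2 with ha
  have hare : 0 < a.re := by
    have : a.re = (t.re + (m + 1)) / 2 := by simp [ha]
    rw [this]; linarith
  have key := Complex.integral_cpow_mul_exp_neg_mul_Ioi hare Real.pi_pos
  rw [← integral_comp_rpow_Ioi_of_pos (p := 2) (by norm_num)] at key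
  have hpi : (1 / (Real.pi : ℂ)) ^ a = (Real.pi : ℂ) ^ (-a) := by
    rw [one_div, Complex.cpow_neg, Complex.inv_cpow]
    rw [Complex.arg_ofReal_of_nonneg Real.pi_pos.le]
    exact Real.pi_pos.ne
  rw [← hpi, ← key, ← integral_const_mul]
  refine setIntegral_congr_fun measurableSet_Ioi fun y hy => ?_
  have hy' : (0 : ℝ) < y := hy
  have hyc : (y : ℂ) ≠ 0 := by exact_mod_cast hy'.ne'
  have h2 : (((y ^ (2 : ℝ) : ℝ) : ℂ)) ^ (a - 1) = (y : ℂ) ^ (2 * (a - 1)) := by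
    rw [Complex.ofReal_cpow hy'.le, ← Complex.ofReal_cpow hy'.le, Complex.cpow_def_of_ne_zero,
      Complex.cpow_def_of_ne_zero hyc, ← Complex.ofReal_log (by positivity),
      ← Complex.ofReal_log hy'.le, Real.log_rpow hy']
    · push_cast; ring_nf
    · exact Complex.ofReal_ne_zero.2 (Real.rpow_pos_of_pos hy' _).ne'
  have h3 : (y : ℂ) ^ (2 * (a - 1)) * y = (y : ℂ) ^ m * (y : ℂ) ^ t := by
    rw [← Complex.cpow_natCast, ← Complex.cpow_add _ _ hyc]
    nth_rw 2 [← Complex.cpow_one (y : ℂ)]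
    rw [← Complex.cpow_add _ _ hyc]
    congr 1
    rw [ha]; push_cast; ring
  simp only [Complex.real_smul]
  rw [h2, absPow_of_pos _ hy']
  norm_num
  linear_combination (-Complex.exp (-(Real.pi * y ^ 2))) * h3

lemma exists_integral_gaussian_absPow_norm (m : ℕ) :
    ∃ c : ℝ, 0 < c ∧ ∀ t : ℂ, -(m + 1 : ℝ) < t.re →
      Integrable (fun v : Fin (m + 1) → ℝ =>
        (Real.exp (-Real.pi * ∑ i, v i ^ 2) : ℂ) * absPow t √(∑ i, v i ^ 2)) ∧
      ∫ v : Fin (m + 1) → ℝ,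
        (Real.exp (-Real.pi * ∑ i, v i ^ 2) : ℂ) * absPow t √(∑ i, v i ^ 2) =
      c * ((Real.pi : ℂ) ^ (-((t + (m + 1 : ℕ)) / 2)) *
        Complex.Gamma ((t + (m + 1 : ℕ)) / 2)) := by
  set b := (volume : Measure (EuclideanSpace ℝ (Fin (m + 1)))).real (Metric.ball 0 1) with hb
  have hb0 : 0 < b :=
    ENNReal.toReal_pos (Metric.measure_ball_pos _ _ one_pos).ne' measure_ball_lt_top.ne
  refine ⟨(m + 1) * b * (1 / 2), by positivity, fun t ht => ?_⟩
  have hval : ∫ v : Fin (m + 1) → ℝ,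
        (Real.exp (-Real.pi * ∑ i, v i ^ 2) : ℂ) * absPow t √(∑ i, v i ^ 2) =
      (((m + 1) * b * (1 / 2) : ℝ) : ℂ) *
        ((Real.pi : ℂ) ^ (-((t + (m + 1 : ℕ)) / 2)) * Complex.Gamma ((t + (m + 1 : ℕ)) / 2)) := by
    have h1 := integral_fun_norm_addHaar (volume : Measure (EuclideanSpace ℝ (Fin (m + 1))))
      (fun y : ℝ => (Real.exp (-Real.pi * y ^ 2) : ℂ) * absPow t y)
    have hd : Module.finrank ℝ (EuclideanSpace ℝ (Fin (m + 1))) = m + 1 := by simp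
    rw [hd, Nat.add_sub_cancel, integral_Ioi_pow_mul_gaussian_absPow m ht] at h1
    rw [← (EuclideanSpace.volume_preserving_symm_measurableEquiv_toLp (Fin (m + 1))).integral_comp
      (MeasurableEquiv.measurableEmbedding _)]
    simp only [EuclideanSpace.norm_eq, Real.norm_eq_abs, sq_abs] at h1
    have h2 : ∀ x : EuclideanSpace ℝ (Fin (m + 1)), √(∑ i, x i ^ 2) ^ 2 = ∑ i, x i ^ 2 := fun x =>
      Real.sq_sqrt (by positivity)
    rw [← hb] at h1
    simp only [h2] at h1
    refine Eq.trans h1 ?_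
    simp only [Complex.real_smul, nsmul_eq_mul]
    push_cast
    ring
  refine ⟨.of_integral_ne_zero ?_, hval⟩
  rw [hval]
  refine mul_ne_zero ?_ (mul_ne_zero ?_ (Complex.Gamma_ne_zero_of_re_pos ?_))
  · exact Complex.ofReal_ne_zero.2 (by positivity)
  · simp [Complex.cpow_eq_zero_iff, Real.pi_ne_zero]
  · have : ((t + (m + 1 : ℕ)) / 2 : ℂ).re = (t.re + (m + 1)) / 2 := by simp
    rw [this]; linarith

lemma Matrix.continuous_rows_vecMul {m n : ℕ} (A : Matrix (Fin n) (Fin n) ℝ) :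
    Continuous fun (Y : Fin m → Fin n → ℝ) i => Matrix.vecMul (Y i) A :=
  continuous_pi fun i => (continuous_apply i).matrix_vecMul continuous_const

lemma Matrix.map_volume_pi_vecMul {m n : ℕ} {A : Matrix (Fin n) (Fin n) ℝ} (hA : A.det ≠ 0) :
    Measure.map (fun (Y : Fin m → Fin n → ℝ) i => Matrix.vecMul (Y i) A) volume =
      ENNReal.ofReal |A.det⁻¹| ^ m • volume := by
  have h := Real.map_matrix_volume_pi_eq_smul_volume_pi (M := A.transpose) (by simpa using hA)
  have hf : (Matrix.toLin' A.transpose : (Fin n → ℝ) → Fin n → ℝ) = fun y => Matrix.vecMul y A := by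
    ext y : 1
    simp [Matrix.toLin'_apply, Matrix.mulVec_transpose]
  rw [hf, Matrix.det_transpose] at h
  have hm : Measurable fun y : Fin n → ℝ => Matrix.vecMul y A := by
    rw [← hf]; exact (LinearMap.continuous_of_finiteDimensional _).measurable
  set c := ENNReal.ofReal |A.det⁻¹| with hc
  have : SigmaFinite (c • (volume : Measure (Fin n → ℝ))) :=
    inferInstanceAs (SigmaFinite (Real.toNNReal |A.det⁻¹| • (volume : Measure (Fin n → ℝ))))
  have hp := (measurePreserving_pi (fun _ : Fin m => (volume : Measure (Fin n → ℝ)))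
    (fun _ : Fin m => c • (volume : Measure (Fin n → ℝ))) (f := fun _ y => Matrix.vecMul y A)
    (fun _ => ⟨hm, h⟩)).map_eq
  refine hp.trans ?_
  refine Measure.pi_eq fun s _ => ?_
  simp [volume_pi, Measure.pi_pi, Finset.prod_mul_distrib]

lemma Matrix.abs_det_of_mul_transpose_eq_one {n : ℕ} {A : Matrix (Fin n) (Fin n) ℝ}
    (hA : A * A.transpose = 1) : |A.det| = 1 := by
  have h := congrArg Matrix.det hA
  rw [Matrix.det_mul, Matrix.det_transpose, Matrix.det_one, ← sq] at h
  rw [← sq_eq_sq₀ (abs_nonneg _) zero_le_one, sq_abs, h, one_pow]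

lemma Matrix.sum_sq_vecMul {n : ℕ} {A : Matrix (Fin n) (Fin n) ℝ}
    (hA : A * A.transpose = 1) (y : Fin n → ℝ) :
    ∑ j, Matrix.vecMul y A j ^ 2 = ∑ j, y j ^ 2 := by
  have h : ∀ w : Fin n → ℝ, ∑ j, w j ^ 2 = w ⬝ᵥ w := fun w => by simp [dotProduct, sq]
  rw [h, h, ← Matrix.dotProduct_mulVec, ← Matrix.vecMul_transpose, Matrix.vecMul_vecMul, hA,
    Matrix.vecMul_one]

lemma Matrix.exists_mul_transpose_eq_one_and_row_zero {m : ℕ} {v : Fin (m + 1) → ℝ} (hv : v ≠ 0) :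
    ∃ A : Matrix (Fin (m + 1)) (Fin (m + 1)) ℝ, A * A.transpose = 1 ∧
      v = Matrix.vecMul (Pi.single 0 √(∑ i, v i ^ 2)) A := by
  set w : EuclideanSpace ℝ (Fin (m + 1)) := WithLp.toLp 2 v with hw
  have hw0 : w ≠ 0 := by simpa [hw] using hv
  have hnorm : ‖w‖ = √(∑ i, v i ^ 2) := by simp [hw, EuclideanSpace.norm_eq]
  have hn0 : ‖w‖ ≠ 0 := norm_ne_zero_iff.2 hw0
  obtain ⟨b, hb⟩ := Orthonormal.exists_orthonormalBasis_extension_of_card_eq (𝕜 := ℝ)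
    (E := EuclideanSpace ℝ (Fin (m + 1))) (ι := Fin (m + 1)) (by simp)
    (v := fun _ => ‖w‖⁻¹ • w) (s := {0}) (by
      refine ⟨fun i => ?_, fun i j hij => (hij (Subsingleton.elim _ _)).elim⟩
      simp [norm_smul, hn0])
  refine ⟨Matrix.of fun i j => b i j, ?_, ?_⟩
  · ext i j
    have := (orthonormal_iff_ite.1 b.orthonormal) j i
    rw [PiLp.inner_apply] at this
    simp only [Matrix.mul_apply, Matrix.transpose_apply, Matrix.of_apply, Matrix.one_apply]
    simp only [RCLike.inner_apply, conj_trivial] at this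
    rw [this]
    simp [eq_comm]
  · ext j
    have h0 := hb 0 rfl
    rw [← hnorm]
    simp only [Matrix.single_vecMul, Matrix.row_apply, Matrix.of_apply, Pi.smul_apply, h0]
    simp only [smul_eq_mul, PiLp.smul_apply]
    rw [mul_inv_cancel_left₀ hn0]

/-- The Gaussian times the `t`-th power of the absolute value of the determinant. -/
noncomputable def gaussianAbsDet (n : ℕ) (t : ℂ) (X : Fin n → Fin n → ℝ) : ℂ :=
  (Real.exp (-Real.pi * ∑ i, ∑ j, X i j ^ 2) : ℂ) * absPow t (Matrix.of X).det

@[fun_prop]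
lemma measurable_gaussianAbsDet (n : ℕ) (t : ℂ) : Measurable (gaussianAbsDet n t) := by
  have hc : Continuous fun X : Fin n → Fin n → ℝ => (Matrix.of X).det :=
    Continuous.matrix_det continuous_id
  have h := hc.measurable
  unfold gaussianAbsDet
  fun_prop

lemma gaussianAbsDet_cons {m : ℕ} (t : ℂ) {v : Fin (m + 1) → ℝ}
    {A : Matrix (Fin (m + 1)) (Fin (m + 1)) ℝ} (hA : A * A.transpose = 1)
    (hv : v = Matrix.vecMul (Pi.single 0 √(∑ i, v i ^ 2)) A) (Y : Fin m → Fin (m + 1) → ℝ) :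
    gaussianAbsDet (m + 1) t (Fin.cons v fun i => Matrix.vecMul (Y i) A) =
      ((Real.exp (-Real.pi * ∑ i, v i ^ 2) : ℂ) * absPow t √(∑ i, v i ^ 2)) *
      ((Real.exp (-Real.pi * ∑ i, Y i 0 ^ 2) : ℂ) *
        gaussianAbsDet m t fun i j => Y i j.succ) := by
  set r := √(∑ i, v i ^ 2) with hr
  have hX : Matrix.of (Fin.cons v fun i => Matrix.vecMul (Y i) A : Fin (m + 1) → Fin (m + 1) → ℝ) =
      Matrix.of (Fin.cons (Pi.single 0 r) Y : Fin (m + 1) → Fin (m + 1) → ℝ) * A := by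
    ext i j
    rw [Matrix.mul_apply_eq_vecMul]
    refine Fin.cases ?_ (fun i => ?_) i
    · conv_lhs => simp only [Matrix.of_apply, Fin.cons_zero]
      exact congrFun hv j
    · rfl
  have hdet : (Matrix.of (Fin.cons (Pi.single 0 r) Y : Fin (m + 1) → Fin (m + 1) → ℝ)).det =
      r * (Matrix.of fun i j : Fin m => Y i j.succ).det := by
    rw [Matrix.det_succ_row_zero, Fin.sum_univ_succ]
    simp [Matrix.submatrix, Fin.succ_ne_zero]
  unfold gaussianAbsDet
  rw [hX, Matrix.det_mul, absPow_mul,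
    absPow_of_abs_eq_one t (Matrix.abs_det_of_mul_transpose_eq_one hA), hdet, absPow_mul, Fin.sum_univ_succ]
  simp only [Fin.cons_zero, Fin.cons_succ, Matrix.sum_sq_vecMul hA]
  have : ∑ i, ∑ j, Y i j ^ 2 = ∑ i, Y i 0 ^ 2 + ∑ i, ∑ j : Fin m, Y i j.succ ^ 2 := by
    rw [← Finset.sum_add_distrib]
    exact Finset.sum_congr rfl fun i _ => Fin.sum_univ_succ _
  rw [this, mul_add, mul_add, Real.exp_add, Real.exp_add]
  push_cast
  ring

lemma integral_exp_neg_pi_mul_sum_sq (m : ℕ) :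
    ∫ h : Fin m → ℝ, (Real.exp (-Real.pi * ∑ i, h i ^ 2) : ℂ) = 1 := by
  have h := GaussianFourier.integral_cexp_neg_mul_sum_add (ι := Fin m) (b := (Real.pi : ℂ))
    (by simpa using Real.pi_pos) 0
  have hpi : (Real.pi : ℂ) ≠ 0 := by simp [Real.pi_ne_zero]
  simpa [hpi] using h

lemma integrable_and_integral_mul_gaussianAbsDet_tail (m : ℕ) {t : ℂ}
    (h : Integrable (gaussianAbsDet m t)) :
    Integrable (fun Y : Fin m → Fin (m + 1) → ℝ =>
      (Real.exp (-Real.pi * ∑ i, Y i 0 ^ 2) : ℂ) * gaussianAbsDet m t fun i j => Y i j.succ) ∧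
    ∫ Y : Fin m → Fin (m + 1) → ℝ,
      (Real.exp (-Real.pi * ∑ i, Y i 0 ^ 2) : ℂ) * gaussianAbsDet m t (fun i j => Y i j.succ) =
      ∫ X, gaussianAbsDet m t X := by
  have hp := MeasurePreserving.trans
    (e := MeasurableEquiv.piCongrRight fun _ : Fin m =>
      MeasurableEquiv.piFinSuccAbove (fun _ : Fin (m + 1) => ℝ) 0)
    (volume_preserving_pi fun _ : Fin m =>
      volume_preserving_piFinSuccAbove (fun _ : Fin (m + 1) => ℝ) 0)
    (volume_measurePreserving_arrowProdEquivProdArrow ℝ (Fin m → ℝ) (Fin m))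
  have hg : Integrable fun h : Fin m → ℝ => (Real.exp (-Real.pi * ∑ i, h i ^ 2) : ℂ) :=
    .of_integral_ne_zero (integral_exp_neg_pi_mul_sum_sq m ▸ one_ne_zero)
  constructor
  · exact (hp.integrable_comp_emb (MeasurableEquiv.measurableEmbedding _)).2 (hg.mul_prod h)
  · have h1 := hp.integral_comp (MeasurableEquiv.measurableEmbedding _) fun p =>
      (Real.exp (-Real.pi * ∑ i, p.1 i ^ 2) : ℂ) * gaussianAbsDet m t p.2
    refine h1.trans ?_
    rw [Measure.volume_eq_prod, integral_prod_mul (fun h : Fin m → ℝ =>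
      (Real.exp (-Real.pi * ∑ i, h i ^ 2) : ℂ)) (gaussianAbsDet m t),
      integral_exp_neg_pi_mul_sum_sq, one_mul]

lemma integrable_and_integral_gaussianAbsDet_cons {m : ℕ} {t : ℂ}
    (h : Integrable (gaussianAbsDet m t)) {v : Fin (m + 1) → ℝ} (hv : v ≠ 0) :
    Integrable (fun Y : Fin m → Fin (m + 1) → ℝ => gaussianAbsDet (m + 1) t (Fin.cons v Y)) ∧
    ∫ Y : Fin m → Fin (m + 1) → ℝ, gaussianAbsDet (m + 1) t (Fin.cons v Y) =
      ((Real.exp (-Real.pi * ∑ i, v i ^ 2) : ℂ) * absPow t √(∑ i, v i ^ 2)) *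
        ∫ X, gaussianAbsDet m t X ∧
    ∫ Y : Fin m → Fin (m + 1) → ℝ, ‖gaussianAbsDet (m + 1) t (Fin.cons v Y)‖ =
      ‖(Real.exp (-Real.pi * ∑ i, v i ^ 2) : ℂ) * absPow t √(∑ i, v i ^ 2)‖ *
        ∫ Y : Fin m → Fin (m + 1) → ℝ, ‖(Real.exp (-Real.pi * ∑ i, Y i 0 ^ 2) : ℂ) *
          gaussianAbsDet m t fun i j => Y i j.succ‖ := by
  obtain ⟨A, hA, hvA⟩ := Matrix.exists_mul_transpose_eq_one_and_row_zero hv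
  obtain ⟨htail, htail_eq⟩ := integrable_and_integral_mul_gaussianAbsDet_tail m h
  have habs := Matrix.abs_det_of_mul_transpose_eq_one hA
  have hmap := Matrix.map_volume_pi_vecMul (m := m) (A := A) (by rintro h0; simp [h0] at habs)
  rw [abs_inv, habs, inv_one, ENNReal.ofReal_one, one_pow, one_smul] at hmap
  let e : (Fin m → Fin (m + 1) → ℝ) ≃ᵐ (Fin m → Fin (m + 1) → ℝ) :=
    { toFun := fun Y i => Matrix.vecMul (Y i) A
      invFun := fun Y i => Matrix.vecMul (Y i) A.transpose
      left_inv := fun Y => by simp [Matrix.vecMul_vecMul, hA]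
      right_inv := fun Y => by simp [Matrix.vecMul_vecMul, mul_eq_one_comm.1 hA]
      measurable_toFun := (Matrix.continuous_rows_vecMul A).measurable
      measurable_invFun := (Matrix.continuous_rows_vecMul A.transpose).measurable }
  have he : MeasurePreserving e := ⟨e.measurable, hmap⟩
  have hcomp : ∀ Y, gaussianAbsDet (m + 1) t (Fin.cons v (e Y)) = _ :=
    gaussianAbsDet_cons t hA hvA
  refine ⟨?_, ?_, ?_⟩
  · rw [← he.integrable_comp_emb e.measurableEmbedding]
    simp only [Function.comp_def, hcomp]
    exact htail.const_mul _
  · rw [← he.integral_comp e.measurableEmbedding]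
    simp only [hcomp]
    rw [integral_const_mul, htail_eq]
  · rw [← he.integral_comp e.measurableEmbedding]
    simp only [hcomp, norm_mul _ (_ * gaussianAbsDet m t _)]
    rw [integral_const_mul]

lemma integrable_and_integral_gaussianAbsDet_succ {m : ℕ} {t : ℂ}
    (h : Integrable (gaussianAbsDet m t))
    (hr : Integrable (fun v : Fin (m + 1) → ℝ =>
        (Real.exp (-Real.pi * ∑ i, v i ^ 2) : ℂ) * absPow t √(∑ i, v i ^ 2))) :
    Integrable (gaussianAbsDet (m + 1) t) ∧
    ∫ X, gaussianAbsDet (m + 1) t X =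
      (∫ v : Fin (m + 1) → ℝ,
        (Real.exp (-Real.pi * ∑ i, v i ^ 2) : ℂ) * absPow t √(∑ i, v i ^ 2)) *
      ∫ X, gaussianAbsDet m t X := by
  have hae : ∀ᵐ v : Fin (m + 1) → ℝ, v ≠ 0 := by simp [ae_iff]
  have hp := (volume_preserving_piFinSuccAbove (fun _ : Fin (m + 1) => Fin (m + 1) → ℝ) 0).symm
  have hsymm : ∀ p : (Fin (m + 1) → ℝ) × (Fin m → Fin (m + 1) → ℝ),
      (MeasurableEquiv.piFinSuccAbove (fun _ : Fin (m + 1) => Fin (m + 1) → ℝ) 0).symm p =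
        Fin.cons p.1 p.2 := fun p => by
    simp [MeasurableEquiv.piFinSuccAbove, Fin.insertNthEquiv]
  have hint : Integrable (fun p : (Fin (m + 1) → ℝ) × (Fin m → Fin (m + 1) → ℝ) =>
      gaussianAbsDet (m + 1) t (Fin.cons p.1 p.2)) := by
    rw [Measure.volume_eq_prod, integrable_prod_iff]
    · refine ⟨?_, (hr.norm.mul_const (∫ Y : Fin m → Fin (m + 1) → ℝ,
        ‖(Real.exp (-Real.pi * ∑ i, Y i 0 ^ 2) : ℂ) *
          gaussianAbsDet m t fun i j => Y i j.succ‖)).congr ?_⟩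
      · filter_upwards [hae] with v hv using (integrable_and_integral_gaussianAbsDet_cons h hv).1
      · filter_upwards [hae] with v hv using
          (integrable_and_integral_gaussianAbsDet_cons h hv).2.2.symm
    · simp only [← hsymm]
      exact ((measurable_gaussianAbsDet _ _).comp
        (MeasurableEquiv.measurable _)).aestronglyMeasurable
  constructor
  · rw [← hp.integrable_comp_emb (MeasurableEquiv.measurableEmbedding _)]
    simpa only [Function.comp_def, hsymm] using hint
  · rw [← hp.integral_comp (MeasurableEquiv.measurableEmbedding _)]
    simp only [hsymm]
    rw [Measure.volume_eq_prod, integral_prod _ hint, ← integral_mul_const]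
    refine integral_congr_ae ?_
    filter_upwards [hae] with v hv using (integrable_and_integral_gaussianAbsDet_cons h hv).2.1

lemma exists_integral_gaussianAbsDet (n : ℕ) :
    ∃ c : ℝ, 0 < c ∧ ∀ t : ℂ, -1 < t.re →
      Integrable (gaussianAbsDet n t) ∧
      ∫ X, gaussianAbsDet n t X = c * ∏ k ∈ Finset.range n,
        ((Real.pi : ℂ) ^ (-((t + (k + 1 : ℕ)) / 2)) * Complex.Gamma ((t + (k + 1 : ℕ)) / 2)) := by
  induction n with
  | zero =>
    refine ⟨1, one_pos, fun t _ => ?_⟩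
    have h : ∫ X, gaussianAbsDet 0 t X = 1 := by
      rw [volume_pi, Measure.pi_of_empty]
      simp [gaussianAbsDet, absPow]
    exact ⟨.of_integral_ne_zero (h ▸ one_ne_zero), by simp [h]⟩
  | succ m ih =>
    obtain ⟨c, hc, hI⟩ := ih
    obtain ⟨d, hd, hJ⟩ := exists_integral_gaussian_absPow_norm m
    refine ⟨d * c, mul_pos hd hc, fun t ht => ?_⟩
    obtain ⟨h1, h2⟩ := hI t ht
    have hm : (0 : ℝ) ≤ m := m.cast_nonneg
    obtain ⟨h3, h4⟩ := hJ t (by linarith)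
    obtain ⟨h5, h6⟩ := integrable_and_integral_gaussianAbsDet_succ h1 h3
    refine ⟨h5, ?_⟩
    rw [h6, h4, h2, Finset.prod_range_succ]
    push_cast
    ring

/-- The transposed matrix entries of an element of `GL_n(ℝ)`. -/
def transposeEntries (n : ℕ) (g : (Matrix (Fin n) (Fin n) ℝ)ˣ) : Fin n → Fin n → ℝ :=
  (g : Matrix (Fin n) (Fin n) ℝ).transpose

section

attribute [local instance] Matrix.linftyOpNormedRing Matrix.linftyOpNormedAlgebra

lemma Matrix.isOpenEmbedding_units_val (n : ℕ) :
    IsOpenEmbedding (Units.val : (Matrix (Fin n) (Fin n) ℝ)ˣ → Matrix (Fin n) (Fin n) ℝ) :=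
  Units.isOpenEmbedding_val

end

lemma isOpenEmbedding_transposeEntries (n : ℕ) : IsOpenEmbedding (transposeEntries n) := by
  let e : Matrix (Fin n) (Fin n) ℝ ≃ₜ (Fin n → Fin n → ℝ) :=
    { toFun := fun X => X.transpose
      invFun := fun X => Matrix.transpose (Matrix.of X)
      left_inv := fun _ => rfl
      right_inv := fun _ => rfl
      continuous_toFun := continuous_id.matrix_transpose
      continuous_invFun := Continuous.matrix_transpose (A := fun X : Fin n → Fin n → ℝ =>
        Matrix.of X) continuous_id }
  exact e.isOpenEmbedding.comp (Matrix.isOpenEmbedding_units_val n)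

lemma Matrix.GL.det_val_ne_zero {n : ℕ} (g : (Matrix (Fin n) (Fin n) ℝ)ˣ) :
    (g : Matrix (Fin n) (Fin n) ℝ).det ≠ 0 :=
  ((Matrix.isUnit_iff_isUnit_det _).1 g.isUnit).ne_zero

lemma range_transposeEntries (n : ℕ) :
    Set.range (transposeEntries n) = {X | (Matrix.of X).det ≠ 0} := by
  ext X
  constructor
  · rintro ⟨g, rfl⟩
    have := Matrix.GL.det_val_ne_zero g
    rwa [← Matrix.det_transpose] at this
  · intro hX
    have hu : IsUnit (Matrix.of X).transpose := by
      rw [Matrix.isUnit_iff_isUnit_det, Matrix.det_transpose]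
      exact isUnit_iff_ne_zero.2 hX
    refine ⟨hu.unit, ?_⟩
    simp only [transposeEntries, IsUnit.unit_spec, Matrix.transpose_transpose]
    rfl

lemma transposeEntries_mul {n : ℕ} (g x : (Matrix (Fin n) (Fin n) ℝ)ˣ) (i : Fin n) :
    transposeEntries n (g * x) i =
      Matrix.vecMul (transposeEntries n x i) (g : Matrix (Fin n) (Fin n) ℝ).transpose := by
  rw [Matrix.vecMul_transpose]
  rfl

lemma continuous_inv_abs_det_pow {n : ℕ} :
    Continuous fun g : (Matrix (Fin n) (Fin n) ℝ)ˣ =>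
      |(g : Matrix (Fin n) (Fin n) ℝ).det|⁻¹ ^ n :=
  ((Units.continuous_val.matrix_det.abs).inv₀
    fun g => abs_ne_zero.2 (Matrix.GL.det_val_ne_zero g)).pow n

lemma smul_exp_mul_exp_eq_gaussianAbsDet {n : ℕ} (s : ℂ) (g : (Matrix (Fin n) (Fin n) ℝ)ˣ) :
    (ENNReal.ofReal (|(g : Matrix (Fin n) (Fin n) ℝ).det|⁻¹ ^ n)).toReal •
      ((Real.exp (-Real.pi * ∑ i : Fin n, ∑ j : Fin n,
          ((g : Matrix (Fin n) (Fin n) ℝ) i j) ^ 2) : ℂ) *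
        Complex.exp (s * Real.log |(g : Matrix (Fin n) (Fin n) ℝ).det|)) =
      gaussianAbsDet n (s - n) (transposeEntries n g) := by
  have hg := Matrix.GL.det_val_ne_zero g
  have hg' := abs_pos.2 hg
  have hdet : (Matrix.of (transposeEntries n g)).det = (g : Matrix (Fin n) (Fin n) ℝ).det :=
    Matrix.det_transpose _
  have hpow : (((|(g : Matrix (Fin n) (Fin n) ℝ).det|⁻¹ ^ n : ℝ)) : ℂ) =
      Complex.exp (-n * Real.log |(g : Matrix (Fin n) (Fin n) ℝ).det|) := by
    rw [← Real.exp_log (inv_pos.2 hg'), Real.log_inv, ← Real.exp_nat_mul]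
    push_cast
    ring_nf
  rw [ENNReal.toReal_ofReal (by positivity), Complex.real_smul, hpow, gaussianAbsDet, hdet,
    absPow, if_neg hg, sub_mul, sub_eq_add_neg, Complex.exp_add, ← neg_mul, Finset.sum_comm]
  simp only [transposeEntries, Matrix.transpose_apply]
  ring

section Haar

variable {n : ℕ} [MeasurableSpace (Matrix (Fin n) (Fin n) ℝ)ˣ]
  [BorelSpace (Matrix (Fin n) (Fin n) ℝ)ˣ]

variable (n) in
/-- Lebesgue measure on the open subset `GL_n(ℝ)` of the matrix algebra. -/
noncomputable def lebesgueGL : Measure (Matrix (Fin n) (Fin n) ℝ)ˣ :=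
  Measure.comap (transposeEntries n) volume

variable (n) in
/-- The Haar measure `|det g| ^ (-n) dg` on `GL_n(ℝ)`. -/
noncomputable def haarGL : Measure (Matrix (Fin n) (Fin n) ℝ)ˣ :=
  (lebesgueGL n).withDensity fun g =>
    ENNReal.ofReal (|(g : Matrix (Fin n) (Fin n) ℝ).det|⁻¹ ^ n)

lemma map_mul_left_lebesgueGL (g : (Matrix (Fin n) (Fin n) ℝ)ˣ) :
    Measure.map (g * ·) (lebesgueGL n) =
      ENNReal.ofReal |(g : Matrix (Fin n) (Fin n) ℝ).det⁻¹| ^ n • lebesgueGL n := by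
  have hφ := (isOpenEmbedding_transposeEntries n).measurableEmbedding
  have hmap := Matrix.map_volume_pi_vecMul (m := n)
    (A := (g : Matrix (Fin n) (Fin n) ℝ).transpose)
    (by simpa using Matrix.GL.det_val_ne_zero g)
  rw [Matrix.det_transpose] at hmap
  ext S hS
  rw [Measure.map_apply (continuous_const_mul g).measurable hS, lebesgueGL, hφ.comap_apply,
    Measure.smul_apply, hφ.comap_apply, ← Measure.smul_apply, ← hmap, Measure.map_apply
    (Matrix.continuous_rows_vecMul _).measurable (hφ.measurableSet_image.2 hS)]
  congr 1
  ext X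
  constructor
  · rintro ⟨x, hx, rfl⟩
    exact ⟨g * x, hx, funext fun i => transposeEntries_mul g x i⟩
  · rintro ⟨y, hy, hyX⟩
    refine ⟨g⁻¹ * y, by simpa using hy, ?_⟩
    funext i
    have hi : transposeEntries n y i = _ := congrFun hyX i
    rw [transposeEntries_mul, hi, Matrix.vecMul_vecMul, ← Matrix.transpose_mul, Units.inv_mul,
      Matrix.transpose_one, Matrix.vecMul_one]

instance isHaarMeasure_haarGL : (haarGL n).IsHaarMeasure := by
  have hφ := isOpenEmbedding_transposeEntries n
  have hdens : Measurable fun g : (Matrix (Fin n) (Fin n) ℝ)ˣ =>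
      ENNReal.ofReal (|(g : Matrix (Fin n) (Fin n) ℝ).det|⁻¹ ^ n) :=
    continuous_inv_abs_det_pow.measurable.ennreal_ofReal
  have hlf : IsLocallyFiniteMeasure (lebesgueGL n) := by
    refine ⟨fun x => ?_⟩
    obtain ⟨U, hxU, hU, hUf⟩ :=
      Measure.exists_isOpen_measure_lt_top (volume : Measure (Fin n → Fin n → ℝ))
        (transposeEntries n x)
    refine ⟨transposeEntries n ⁻¹' U, (hU.preimage hφ.continuous).mem_nhds hxU, ?_⟩
    rw [lebesgueGL, hφ.measurableEmbedding.comap_apply]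
    exact (measure_mono (Set.image_preimage_subset _ _)).trans_lt hUf
  have hop : (lebesgueGL n).IsOpenPosMeasure := Measure.IsOpenPosMeasure.comap _ hφ
  have hlf' : IsLocallyFiniteMeasure (haarGL n) :=
    IsLocallyFiniteMeasure.withDensity_ofReal continuous_inv_abs_det_pow
  have hop' : (haarGL n).IsOpenPosMeasure := by
    refine Measure.AbsolutelyContinuous.isOpenPosMeasure (μ := lebesgueGL n)
      (withDensity_absolutelyContinuous' hdens.aemeasurable (.of_forall fun g => ?_))
    have := abs_pos.2 (Matrix.GL.det_val_ne_zero g)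
    exact (ENNReal.ofReal_pos.2 (by positivity)).ne'
  have hinv : (haarGL n).IsMulLeftInvariant := by
    refine ⟨fun g => ?_⟩
    have hg : 0 < |(g : Matrix (Fin n) (Fin n) ℝ).det| := abs_pos.2 (Matrix.GL.det_val_ne_zero g)
    ext S hS
    rw [Measure.map_apply (continuous_const_mul g).measurable hS, haarGL,
      withDensity_apply _ ((continuous_const_mul g).measurable hS), withDensity_apply _ hS]
    have hfac : ∀ x : (Matrix (Fin n) (Fin n) ℝ)ˣ,
        ENNReal.ofReal (|(x : Matrix (Fin n) (Fin n) ℝ).det|⁻¹ ^ n) =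
          ENNReal.ofReal (|(g : Matrix (Fin n) (Fin n) ℝ).det| ^ n) *
          ENNReal.ofReal (|((g * x : (Matrix (Fin n) (Fin n) ℝ)ˣ) :
            Matrix (Fin n) (Fin n) ℝ).det|⁻¹ ^ n) := fun x => by
      rw [← ENNReal.ofReal_mul (by positivity), Units.val_mul, Matrix.det_mul, abs_mul, mul_inv,
        mul_pow, ← mul_assoc, ← mul_pow, mul_inv_cancel₀ hg.ne', one_pow, one_mul]
    rw [lintegral_congr hfac, lintegral_const_mul _ (by exact hdens.comp (continuous_const_mul g).measurable), ← setLIntegral_map hS hdens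
      (continuous_const_mul g).measurable, map_mul_left_lebesgueGL, Measure.restrict_smul,
      lintegral_smul_measure, smul_eq_mul, ← mul_assoc, abs_inv,
      ← ENNReal.ofReal_pow (by positivity), ← ENNReal.ofReal_mul (by positivity), ← mul_pow,
      mul_inv_cancel₀ hg.ne', one_pow, ENNReal.ofReal_one, one_mul]
  exact {}

lemma integrable_and_integral_comp_transposeEntries {F : (Fin n → Fin n → ℝ) → ℂ}
    (hF : Integrable F) (hF0 : ∀ X, (Matrix.of X).det = 0 → F X = 0) :
    Integrable (fun g => F (transposeEntries n g)) (lebesgueGL n) ∧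
      ∫ g, F (transposeEntries n g) ∂lebesgueGL n = ∫ X, F X := by
  have hφ := (isOpenEmbedding_transposeEntries n).measurableEmbedding
  have hmap : Measure.map (transposeEntries n) (lebesgueGL n) =
      volume.restrict (Set.range (transposeEntries n)) := hφ.map_comap _
  refine ⟨hφ.integrable_map_iff.1 (hmap ▸ hF.integrableOn), ?_⟩
  rw [← hφ.integral_map, hmap]
  refine setIntegral_eq_integral_of_forall_compl_eq_zero fun X hX => hF0 X ?_
  simpa [range_transposeEntries] using hX

lemma integrable_and_integral_haarGL {s : ℂ} (h : Integrable (gaussianAbsDet n (s - n))) :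
    Integrable (fun g : (Matrix (Fin n) (Fin n) ℝ)ˣ =>
      (Real.exp (-Real.pi * ∑ i : Fin n, ∑ j : Fin n,
          ((g : Matrix (Fin n) (Fin n) ℝ) i j) ^ 2) : ℂ) *
        Complex.exp (s * Real.log |(g : Matrix (Fin n) (Fin n) ℝ).det|)) (haarGL n) ∧
    ∫ g : (Matrix (Fin n) (Fin n) ℝ)ˣ,
      (Real.exp (-Real.pi * ∑ i : Fin n, ∑ j : Fin n,
          ((g : Matrix (Fin n) (Fin n) ℝ) i j) ^ 2) : ℂ) *
        Complex.exp (s * Real.log |(g : Matrix (Fin n) (Fin n) ℝ).det|) ∂haarGL n =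
      ∫ X, gaussianAbsDet n (s - n) X := by
  have hdens : Measurable fun g : (Matrix (Fin n) (Fin n) ℝ)ˣ =>
      ENNReal.ofReal (|(g : Matrix (Fin n) (Fin n) ℝ).det|⁻¹ ^ n) :=
    continuous_inv_abs_det_pow.measurable.ennreal_ofReal
  have hfin : ∀ᵐ g : (Matrix (Fin n) (Fin n) ℝ)ˣ ∂lebesgueGL n,
      ENNReal.ofReal (|(g : Matrix (Fin n) (Fin n) ℝ).det|⁻¹ ^ n) < ⊤ :=
    .of_forall fun _ => ENNReal.ofReal_lt_top
  rw [haarGL, integrable_withDensity_iff_integrable_smul' hdens hfin,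
    integral_withDensity_eq_integral_toReal_smul hdens hfin]
  simp only [smul_exp_mul_exp_eq_gaussianAbsDet]
  exact integrable_and_integral_comp_transposeEntries h fun X hX => by
    simp [gaussianAbsDet, absPow, hX]

end Haar

/-- there is a constant `c > 0` (depending only on `n` and the Haar
measure `μ` on `GL_n(ℝ)`) such that for all `s ∈ ℂ` with `Re(s) > n − 1`, the
function `g ↦ exp(−π‖g‖²)·|det g|^s` (with `|det g|^s = exp(s·log|det g|)`) is
`μ`-integrable and its integral equals `c · ∏_{k=0}^{n−1} π^{−(s−k)/2} Γ((s−k)/2)`. -/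
theorem stmt_18 (n : ℕ) (hn : 1 ≤ n)
    [MeasurableSpace (Matrix (Fin n) (Fin n) ℝ)ˣ]
    [BorelSpace (Matrix (Fin n) (Fin n) ℝ)ˣ]
    (μ : Measure (Matrix (Fin n) (Fin n) ℝ)ˣ) [μ.IsHaarMeasure] :
    ∃ c : ℝ, 0 < c ∧ ∀ s : ℂ, (n : ℝ) - 1 < s.re →
      Integrable
        (fun g : (Matrix (Fin n) (Fin n) ℝ)ˣ =>
          (Real.exp (-Real.pi *
              ∑ i : Fin n, ∑ j : Fin n,
                ((g : Matrix (Fin n) (Fin n) ℝ) i j) ^ 2) : ℂ) *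
            Complex.exp (s * Real.log |(g : Matrix (Fin n) (Fin n) ℝ).det|)) μ ∧
      ∫ g : (Matrix (Fin n) (Fin n) ℝ)ˣ,
          (Real.exp (-Real.pi *
              ∑ i : Fin n, ∑ j : Fin n,
                ((g : Matrix (Fin n) (Fin n) ℝ) i j) ^ 2) : ℂ) *
            Complex.exp (s * Real.log |(g : Matrix (Fin n) (Fin n) ℝ).det|) ∂μ
        = (c : ℂ) * ∏ k ∈ Finset.range n,
            ((Real.pi : ℂ) ^ (-((s - (k : ℂ)) / 2)) *
              Complex.Gamma ((s - (k : ℂ)) / 2)) := by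
  have : SecondCountableTopology (Matrix (Fin n) (Fin n) ℝ)ˣ :=
    (isOpenEmbedding_transposeEntries n).isEmbedding.secondCountableTopology
  have : LocallyCompactSpace (Matrix (Fin n) (Fin n) ℝ)ˣ :=
    (isOpenEmbedding_transposeEntries n).locallyCompactSpace
  set κ := Measure.haarScalarFactor μ (haarGL n)
  have hκ : 0 < κ := Measure.haarScalarFactor_pos_of_isHaarMeasure μ (haarGL n)
  have hμ : μ = κ • haarGL n := Measure.isMulLeftInvariant_eq_smul μ (haarGL n)
  obtain ⟨c, hc, hI⟩ := exists_integral_gaussianAbsDet n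
  refine ⟨κ * c, by positivity, fun s hs => ?_⟩
  obtain ⟨h1, h2⟩ := hI (s - n) (by simp only [Complex.sub_re, Complex.natCast_re]; linarith)
  obtain ⟨h3, h4⟩ := integrable_and_integral_haarGL h1
  rw [hμ]
  refine ⟨h3.smul_measure_nnreal, ?_⟩
  rw [integral_smul_nnreal_measure, h4, h2, ← Finset.prod_range_reflect, NNReal.smul_def,
    Complex.real_smul, Complex.ofReal_mul, mul_assoc]
  congr 2
  refine Finset.prod_congr rfl fun k hk => ?_
  have hkn : n - 1 - k + 1 + k = n := by have := Finset.mem_range.1 hk; omega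
  have : s - (n : ℂ) + (n - 1 - k + 1 : ℕ) = s - k := by
    nth_rw 1 [← hkn]
    push_cast
    ring
  rw [this]
end

section
/- There exists a constant c > 0 (depending only on n, p and on the normalization of μ) such that for every complex number s with Re(s) > n − 1, the function g ↦ 1_{M_n(ℤ_p)}(g) · |det g|_p^{s} is μ-integrable on GL_n(ℚ_p) and ∫_{GL_n(ℚ_p)} 1_{M_n(ℤ_p)}(g) |det g|_p^{s} dμ(g) = c · ∏_{k=0}^{n−1} (1 − p^{−(s−k)})^{−1}, where 1_{M_n(ℤ_p)} denotes the indicator function of the set of matrices with entries in ℤ_p. -/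
open MeasureTheory

open Matrix in
/-- The block matrix `[[A, v], [0, a]]` with a column vector `v` and a scalar `a`. -/
def Matrix.borderUpper {ι R : Type} [Zero R] (A : Matrix ι ι R) (v : ι → R) (a : R) :
    Matrix (ι ⊕ Unit) (ι ⊕ Unit) R :=
  fromBlocks A (replicateCol Unit v) 0 (of fun _ _ => a)

namespace Matrix

section BorderUpper

variable {ι R : Type} [CommRing R]

theorem borderUpper_inj {A A' : Matrix ι ι R} {v v' : ι → R} {a a' : R}
    (h : borderUpper A v a = borderUpper A' v' a') : A = A' ∧ v = v' ∧ a = a' := by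
  obtain ⟨h₁, h₂, -, h₄⟩ := fromBlocks_inj.1 h
  exact ⟨h₁, replicateCol_injective h₂, congrFun (congrFun h₄ ()) ()⟩

theorem eq_borderUpper_of_apply_eq_zero (g : Matrix (ι ⊕ Unit) (ι ⊕ Unit) R)
    (h : ∀ i, g (Sum.inr ()) (Sum.inl i) = 0) :
    g = borderUpper g.toBlocks₁₁ (fun i => g (Sum.inl i) (Sum.inr ()))
      (g (Sum.inr ()) (Sum.inr ())) := by
  ext (i | i) (j | j) <;> simp [borderUpper, toBlocks₁₁, h]

variable [Fintype ι]

theorem borderUpper_mul (A A' : Matrix ι ι R) (v v' : ι → R) (a a' : R) :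
    borderUpper A v a * borderUpper A' v' a' =
      borderUpper (A * A') (A *ᵥ v' + a' • v) (a * a') := by
  ext (i | i) (j | j) <;>
    simp [borderUpper, mul_apply, mulVec, dotProduct, mul_comm]

theorem borderUpper_mulVec (A : Matrix ι ι R) (v : ι → R) (a : R) (w : ι → R) (b : R) :
    borderUpper A v a *ᵥ Sum.elim w (fun _ => b) =
      Sum.elim (A *ᵥ w + b • v) (fun _ => a * b) := by
  ext (i | i) <;> simp [borderUpper, mulVec, dotProduct, mul_comm]

variable [DecidableEq ι]

theorem det_borderUpper (A : Matrix ι ι R) (v : ι → R) (a : R) :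
    (borderUpper A v a).det = A.det * a := by
  simp [borderUpper, det_fromBlocks_zero₂₁]

end BorderUpper

end Matrix

section Padic

open Matrix

variable {p : ℕ} [hp : Fact p.Prime]

theorem PadicInt.dvd_of_norm_le {a b : ℤ_[p]} (h : ‖a‖ ≤ ‖b‖) : b ∣ a := by
  rcases eq_or_ne b 0 with rfl | hb
  · simp only [norm_zero, norm_le_zero_iff] at h
    simp [h]
  · have hb' : (b : ℚ_[p]) ≠ 0 := by simpa using hb
    refine ⟨⟨(a : ℚ_[p]) / b, ?_⟩, ?_⟩
    · rw [norm_div]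
      exact div_le_one_of_le₀ h (norm_nonneg _)
    · apply PadicInt.ext
      change (a : ℚ_[p]) = b * (a / b)
      exact (mul_div_cancel₀ _ hb').symm

theorem PadicInt.exists_eq_natCast_add_pow_mul (d : ℕ) (x : ℤ_[p]) :
    ∃ (t : Fin (p ^ d)) (w : ℤ_[p]), x = (t : ℕ) + p ^ d * w := by
  obtain ⟨w, hw⟩ := Ideal.mem_span_singleton.1 (PadicInt.appr_spec d x)
  exact ⟨⟨_, PadicInt.appr_lt x d⟩, w, by rw [← hw]; ring⟩

theorem PadicInt.fin_ext_of_eq_add_pow_mul {d : ℕ} {t t' : Fin (p ^ d)} {w : ℤ_[p]}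
    (h : ((t : ℕ) : ℤ_[p]) = (t' : ℕ) + p ^ d * w) : t = t' := by
  have h1 := congrArg (PadicInt.toZModPow d) h
  have h2 : PadicInt.toZModPow d ((p : ℤ_[p]) ^ d) = 0 := by
    rw [← RingHom.mem_ker, PadicInt.ker_toZModPow]
    exact Ideal.mem_span_singleton_self _
  rw [map_add, map_mul, h2, zero_mul, add_zero, map_natCast, map_natCast,
    ZMod.natCast_eq_natCast_iff', Nat.mod_eq_of_lt t.2, Nat.mod_eq_of_lt t'.2] at h1
  exact Fin.ext h1

/-- Column reduction of the last row of a nonsingular matrix over `ℤ_[p]`. -/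
theorem PadicInt.exists_mul_eq_borderUpper {ι : Type} [Fintype ι] [DecidableEq ι]
    (g : Matrix (ι ⊕ Unit) (ι ⊕ Unit) ℤ_[p]) (hg : g.det ≠ 0) :
    ∃ (k : Matrix (ι ⊕ Unit) (ι ⊕ Unit) ℤ_[p]) (A : Matrix ι ι ℤ_[p]) (v : ι → ℤ_[p]) (d : ℕ),
      IsUnit k.det ∧ g * k = borderUpper A v (p ^ d) := by
  obtain ⟨j, hj⟩ := Finite.exists_max fun j => ‖g (Sum.inr ()) j‖
  have hb : g (Sum.inr ()) j ≠ 0 := fun h0 =>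
    hg <| det_eq_zero_of_row_eq_zero (Sum.inr ()) fun i => by simpa [h0] using hj i
  have hdvd := fun i => PadicInt.dvd_of_norm_le (hj i)
  choose c hc using hdvd
  set b := g (Sum.inr ()) j with hbdef
  set u := PadicInt.unitCoeff hb
  have hbu : b = u * p ^ b.valuation := PadicInt.unitCoeff_spec hb
  let σ : Equiv.Perm (ι ⊕ Unit) := Equiv.swap (Sum.inr ()) j
  let P : Matrix (ι ⊕ Unit) (ι ⊕ Unit) ℤ_[p] := (1 : Matrix _ _ ℤ_[p]).submatrix id σ
  let k : Matrix (ι ⊕ Unit) (ι ⊕ Unit) ℤ_[p] :=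
    fromBlocks 1 0 (of fun _ i => -c (σ (Sum.inl i))) (of fun _ _ => ((u⁻¹ : ℤ_[p]ˣ) : ℤ_[p]))
  have hP : ∀ i, (g * P) (Sum.inr ()) i = b * c (σ i) := fun i => by
    have : g * P = g.submatrix id σ := by
      ext i l
      simp [P, mul_apply, one_apply]
    rw [this, ← hc]
    rfl
  have hc1 : c j = 1 := mul_left_cancel₀ hb (by rw [← hc j, mul_one])
  have hσ : σ (Sum.inr ()) = j := Equiv.swap_apply_left _ _
  have h0 : ∀ i, (g * (P * k)) (Sum.inr ()) (Sum.inl i) = 0 := fun i => by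
    rw [← mul_assoc, mul_apply]
    simp [hP, k, hσ, hc1, one_apply]
  have h1 : (g * (P * k)) (Sum.inr ()) (Sum.inr ()) = p ^ b.valuation := by
    rw [← mul_assoc, mul_apply]
    simp only [hP, k, Fintype.sum_sum_type]
    simp only [fromBlocks_apply₁₂, fromBlocks_apply₂₂, Matrix.zero_apply, mul_zero,
      Finset.sum_const_zero, zero_add, Finset.univ_unique, PUnit.default_eq_unit, of_apply,
      Finset.sum_singleton, hσ, hc1, mul_one]
    rw [hbu, mul_right_comm, Units.mul_inv, one_mul, ← hbu]
  refine ⟨P * k, _, _, b.valuation, ?_, h1 ▸ eq_borderUpper_of_apply_eq_zero _ h0⟩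
  rw [det_mul]
  refine IsUnit.mul ?_ ?_
  · simp only [P, det_permute', det_one, mul_one]
    exact ((Equiv.Perm.sign σ).isUnit.map (Int.castRingHom ℤ_[p]))
  · simp [k, det_fromBlocks_zero₁₂]

end Padic

section HermiteSystem

open Matrix

/-- A system of representatives `rep` for the nonsingular matrices over `ℤ_[p]` modulo right
multiplication by invertible matrices, where `rep x` has determinant `p ^ exponent x`, together
with representatives `digit x` of the cokernel of each `rep x`. -/
structure HermiteSystem (p : ℕ) [Fact p.Prime] (ι : Type) [Fintype ι] [DecidableEq ι] where
  Index : Type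
  countable : Countable Index
  rep : Index → Matrix ι ι ℤ_[p]
  exponent : Index → ℕ
  digit : (x : Index) → Fin (p ^ exponent x) → ι → ℤ_[p]
  det_rep : ∀ x, (rep x).det = p ^ exponent x
  exists_eq_mul : ∀ g : Matrix ι ι ℤ_[p], g.det ≠ 0 → ∃ x k, IsUnit k.det ∧ g = rep x * k
  index_eq : ∀ x y k, IsUnit k.det → rep x = rep y * k → x = y
  exists_digit : ∀ x v, ∃ t w, v = digit x t + rep x *ᵥ w
  digit_eq : ∀ x t t' w, digit x t = digit x t' + rep x *ᵥ w → t = t'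
  hasSum : ∀ X : ℂ, ‖X‖ * p ^ Fintype.card ι < p →
    HasSum (fun x => X ^ exponent x) (∏ k ∈ Finset.range (Fintype.card ι), (1 - p ^ k * X)⁻¹)

theorem hasSum_pow_add_prod_fin {𝕜 : Type} [RCLike 𝕜] (N e : ℕ) {X : 𝕜} (hX : ‖X‖ < 1) :
    HasSum (fun y : ℕ × Fin N => X ^ (e + y.1)) (N * X ^ e * (1 - X)⁻¹) := by
  have h1 : HasSum (fun d : ℕ => X ^ d) (1 - X)⁻¹ := hasSum_geometric_of_norm_lt_one hX
  have h2 : HasSum (fun _ : Fin N => X ^ e) (N * X ^ e) := by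
    simpa only [Finset.sum_const, Finset.card_univ, Fintype.card_fin, nsmul_eq_mul] using
      hasSum_fintype (fun _ : Fin N => X ^ e)
  have h3 : Summable fun y : Fin N × ℕ => X ^ e * X ^ y.2 := 
    summable_mul_of_summable_norm (f := fun _ : Fin N => X ^ e) (g := fun d : ℕ => X ^ d)
      (Summable.of_finite) (by simpa using hX)
  have h4 := h2.mul h1 h3
  have h5 := (Equiv.prodComm ℕ (Fin N)).hasSum_iff.2 h4
  simp only [pow_add]
  exact h5

theorem hasSum_sigma_pow_add {p : ℕ} {I : Type} {e : I → ℕ} {X L : ℂ} (hX : ‖X‖ < 1)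
    (h : HasSum (fun x => (p * X) ^ e x) L) :
    HasSum (fun y : Σ x : I, ℕ × Fin (p ^ e x) => X ^ (e y.1 + y.2.1)) (L * (1 - X)⁻¹) := by
  have hnorm : ‖‖X‖‖ < 1 := by simpa using hX
  refine HasSum.sigma_of_hasSum (h.mul_right (1 - X)⁻¹) (fun x => ?_) ?_
  · simpa [mul_pow] using hasSum_pow_add_prod_fin (p ^ e x) (e x) hX
  · refine Summable.of_norm ?_
    simp only [norm_pow]
    rw [summable_sigma_of_nonneg fun _ => by positivity]
    have hf := fun x => hasSum_pow_add_prod_fin (p ^ e x) (e x) hnorm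
    refine ⟨fun x => (hf x).summable, ?_⟩
    simp only [fun x => (hf x).tsum_eq]
    refine Summable.mul_right _ (h.summable.norm.congr fun x => ?_)
    simp [mul_pow]

namespace HermiteSystem

variable {p : ℕ} [hp : Fact p.Prime]

/-- The system for matrices of size zero. -/
noncomputable def ofIsEmpty (p : ℕ) [Fact p.Prime] (ι : Type) [Fintype ι] [DecidableEq ι]
    [IsEmpty ι] : HermiteSystem p ι where
  Index := Unit
  countable := inferInstance
  rep _ := 1
  exponent _ := 0
  digit _ _ := 0
  det_rep _ := by simp
  exists_eq_mul g _ := ⟨(), 1, by simp, Subsingleton.elim _ _⟩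
  index_eq _ _ _ _ _ := rfl
  exists_digit _ _ := ⟨0, 0, Subsingleton.elim _ _⟩
  digit_eq _ _ _ _ _ := Subsingleton.elim (α := Fin 1) _ _
  hasSum X _ := by simp

variable {ι : Type} [Fintype ι] [DecidableEq ι]

/-- Transport of a system along a bijection of the index types. -/
noncomputable def reindex {κ : Type} [Fintype κ] [DecidableEq κ] (H : HermiteSystem p ι) (e : ι ≃ κ) :
    HermiteSystem p κ where
  Index := H.Index
  countable := H.countable
  rep x := (H.rep x).submatrix e.symm e.symm
  exponent := H.exponent
  digit x t := H.digit x t ∘ e.symm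
  det_rep x := by simp [H.det_rep]
  exists_eq_mul g hg := by
    obtain ⟨x, k, hk, h⟩ := H.exists_eq_mul (g.submatrix e e) (by simpa using hg)
    refine ⟨x, k.submatrix e.symm e.symm, by simpa using hk, ?_⟩
    rw [submatrix_mul_equiv, ← h]
    simp
  index_eq x y k hk h := by
    refine H.index_eq x y (k.submatrix e e) (by simpa using hk) ?_
    have := congrArg (fun M => M.submatrix e e) h
    simpa [← submatrix_mul_equiv _ _ e e e] using this
  exists_digit x v := by
    obtain ⟨t, w, h⟩ := H.exists_digit x (v ∘ e)
    refine ⟨t, w ∘ e.symm, ?_⟩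
    ext i
    have := congrFun h (e.symm i)
    simpa [submatrix_mulVec_equiv, Function.comp_assoc] using this
  digit_eq x t t' w h := by
    refine H.digit_eq x t t' (w ∘ e) ?_
    ext i
    have := congrFun h (e i)
    simpa [submatrix_mulVec_equiv] using this
  hasSum X hX := by
    rw [← Fintype.card_congr e] at hX ⊢
    exact H.hasSum X hX

/-- The bijection splitting a digit modulo `p ^ (a + b)` into digits modulo `p ^ a`, `p ^ b`. -/
def splitDigit (p a b : ℕ) : Fin (p ^ (a + b)) ≃ Fin (p ^ a) × Fin (p ^ b) :=
  (finCongr (pow_add p a b)).trans finProdFinEquiv.symm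

/-- Passage to matrices with one more row and column. -/
noncomputable def border (H : HermiteSystem p ι) : HermiteSystem p (ι ⊕ Unit) where
  Index := Σ x : H.Index, ℕ × Fin (p ^ H.exponent x)
  countable := have := H.countable; inferInstance
  rep x := borderUpper (H.rep x.1) (H.digit x.1 x.2.2) (p ^ x.2.1)
  exponent x := H.exponent x.1 + x.2.1
  digit x t := Sum.elim (H.digit x.1 (splitDigit p _ _ t).1)
    (fun _ => ((splitDigit p _ _ t).2 : ℕ))
  det_rep x := by rw [det_borderUpper, H.det_rep, pow_add]
  exists_eq_mul g hg := by
    obtain ⟨k, A, v, d, hk, h⟩ := PadicInt.exists_mul_eq_borderUpper g hg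
    have hA : A.det ≠ 0 := fun h0 => by
      have := congrArg Matrix.det h
      rw [det_mul, det_borderUpper, h0, zero_mul] at this
      exact (mul_ne_zero hg hk.ne_zero) this
    obtain ⟨x, k', hk', rfl⟩ := H.exists_eq_mul A hA
    obtain ⟨t, w, rfl⟩ := H.exists_digit x v
    refine ⟨⟨x, d, t⟩, borderUpper k' w 1 * k⁻¹, ?_, ?_⟩
    · rw [det_mul, det_borderUpper, mul_one]
      exact hk'.mul (isUnit_nonsing_inv_det _ hk)
    · rw [← mul_assoc, borderUpper_mul, one_smul, mul_one, add_comm, ← h,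
        mul_nonsing_inv_cancel_right _ _ hk]
  index_eq := by
    rintro ⟨x, d, t⟩ ⟨y, d', t'⟩ k hk h
    have hp0 : (p : ℤ_[p]) ≠ 0 := Nat.cast_ne_zero.2 hp.out.ne_zero
    have hk0 : ∀ i, k (Sum.inr ()) (Sum.inl i) = 0 := fun i => by
      have := congrFun (congrFun h (Sum.inr ())) (Sum.inl i)
      simpa [borderUpper, mul_apply, hp0] using this
    rw [eq_borderUpper_of_apply_eq_zero k hk0] at h hk
    set A := k.toBlocks₁₁
    set v := fun i => k (Sum.inl i) (Sum.inr ())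
    set a := k (Sum.inr ()) (Sum.inr ())
    rw [det_borderUpper] at hk
    have hA := isUnit_of_mul_isUnit_left hk
    have ha := isUnit_of_mul_isUnit_right hk
    dsimp only at h
    rw [borderUpper_mul] at h
    obtain ⟨h1, h2, h3⟩ := borderUpper_inj h
    obtain rfl := H.index_eq x y A hA h1
    have hd : d = d' := by
      have := congrArg norm h3
      rw [norm_mul, PadicInt.isUnit_iff.1 ha, mul_one, PadicInt.norm_p_pow, PadicInt.norm_p_pow]
        at this
      have := zpow_right_injective₀ (by exact_mod_cast hp.out.pos)
        (by exact_mod_cast hp.out.one_lt.ne') this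
      omega
    subst hd
    have ha1 : a = 1 := mul_left_cancel₀ (pow_ne_zero d hp0) (by rw [← h3, mul_one])
    rw [ha1, one_smul, add_comm] at h2
    rw [H.digit_eq _ _ _ _ h2]
  exists_digit x v := by
    obtain ⟨s, b, hb⟩ := PadicInt.exists_eq_natCast_add_pow_mul x.2.1 (v (Sum.inr ()))
    obtain ⟨t, w, hw⟩ := H.exists_digit x.1 (v ∘ Sum.inl - b • H.digit x.1 x.2.2)
    refine ⟨(splitDigit p _ _).symm (t, s), Sum.elim w fun _ => b, ?_⟩
    rw [borderUpper_mulVec, Equiv.apply_symm_apply]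
    ext (i | i)
    · have := congrFun hw i
      simp only [Pi.sub_apply, Function.comp_apply, Pi.add_apply, Sum.elim_inl] at this ⊢
      rw [← add_assoc, ← this]
      ring
    · simpa using hb
  digit_eq x t t' w h := by
    have hw : w = Sum.elim (w ∘ Sum.inl) (fun _ => w (Sum.inr ())) := by
      ext (i | i) <;> rfl
    rw [hw, borderUpper_mulVec] at h
    apply (splitDigit p _ _).injective
    have h2 : (splitDigit p _ _ t).2 = (splitDigit p _ _ t').2 :=
      PadicInt.fin_ext_of_eq_add_pow_mul (by simpa using congrFun h (Sum.inr ()))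
    have h3 : w (Sum.inr ()) = 0 := by
      have := congrFun h (Sum.inr ())
      simpa [h2, hp.out.ne_zero] using this
    refine Prod.ext (H.digit_eq x.1 _ _ (w ∘ Sum.inl) ?_) h2
    ext i
    have := congrFun h (Sum.inl i)
    simpa [h3] using this
  hasSum X hX := by
    have hp0 : (0 : ℝ) < p := Nat.cast_pos.2 hp.out.pos
    have hp1 : (1 : ℝ) ≤ p := Nat.one_le_cast.2 hp.out.one_le
    rw [Fintype.card_sum, Fintype.card_unit] at hX ⊢
    have hX' : ‖X‖ * p ^ Fintype.card ι < 1 := by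
      rw [pow_succ, ← mul_assoc] at hX
      exact (mul_lt_iff_lt_one_left hp0).1 hX
    have hX1 : ‖X‖ < 1 :=
      (le_mul_of_one_le_right (norm_nonneg X) (one_le_pow₀ hp1)).trans_lt hX'
    have hpX : ‖(p : ℂ) * X‖ * p ^ Fintype.card ι < p := by
      rw [norm_mul, Complex.norm_natCast, mul_assoc]
      exact mul_lt_of_lt_one_right hp0 hX'
    have := hasSum_sigma_pow_add hX1 (H.hasSum _ hpX)
    rw [Finset.prod_range_succ']
    simpa only [pow_succ, pow_zero, one_mul, mul_assoc] using this

/-- The system for square matrices indexed by `Fin n`. -/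
noncomputable def ofFin (p : ℕ) [Fact p.Prime] : (n : ℕ) → HermiteSystem p (Fin n)
  | 0 => ofIsEmpty p (Fin 0)
  | n + 1 => (ofFin p n).border.reindex
      ((Equiv.sumCongr (Equiv.refl _) (Equiv.ofUnique _ _)).trans finSumFinEquiv)

end HermiteSystem

end HermiteSystem

section Measure

open Matrix
open scoped Pointwise

variable (p : ℕ) [hp : Fact p.Prime] (n : ℕ)

/-- The subgroup `GL_n(ℤ_p)` of the group of units of `M_n(ℚ_p)`. -/
noncomputable def integralUnits : Subgroup (Matrix (Fin n) (Fin n) ℚ_[p])ˣ :=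
  (PadicInt.subring p).matrix.toSubmonoid.units

variable {p n}

theorem mem_integralUnits_iff {g : (Matrix (Fin n) (Fin n) ℚ_[p])ˣ} :
    g ∈ integralUnits p n ↔ (∀ i j, ‖(g : Matrix (Fin n) (Fin n) ℚ_[p]) i j‖ ≤ 1) ∧
      ∀ i j, ‖((g⁻¹ : (Matrix (Fin n) (Fin n) ℚ_[p])ˣ) : Matrix (Fin n) (Fin n) ℚ_[p]) i j‖ ≤ 1 :=
  Iff.rfl

theorem isOpen_setOf_forall_norm_le_one :
    IsOpen {M : Matrix (Fin n) (Fin n) ℚ_[p] | ∀ i j, ‖M i j‖ ≤ 1} := by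
  simp only [Set.ofPred_forall]
  refine isOpen_iInter_of_finite fun i => isOpen_iInter_of_finite fun j => ?_
  have h : IsOpen {x : ℚ_[p] | ‖x‖ ≤ 1} := by
    simpa [Metric.closedBall] using IsUltrametricDist.isOpen_closedBall (0 : ℚ_[p]) one_ne_zero
  exact h.preimage (continuous_id.matrix_elem i j)

theorem isCompact_setOf_forall_norm_le_one :
    IsCompact {M : Matrix (Fin n) (Fin n) ℚ_[p] | ∀ i j, ‖M i j‖ ≤ 1} := by
  have h : IsCompact {x : ℚ_[p] | ‖x‖ ≤ 1} := by
    simpa [Metric.closedBall] using isCompact_closedBall (0 : ℚ_[p]) 1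
  have := isCompact_univ_pi (s := fun _ : Fin n => _) fun _ =>
    isCompact_univ_pi (s := fun _ : Fin n => _) fun _ => h
  change IsCompact (X := Fin n → Fin n → ℚ_[p]) {M | ∀ i j, ‖M i j‖ ≤ 1}
  simpa [Set.pi] using this

theorem isOpen_integralUnits : IsOpen (integralUnits p n : Set (Matrix (Fin n) (Fin n) ℚ_[p])ˣ) :=
  (isOpen_setOf_forall_norm_le_one.preimage Units.continuous_val).inter
    (isOpen_setOf_forall_norm_le_one.preimage Units.continuous_coe_inv)

theorem isCompact_integralUnits :
    IsCompact (integralUnits p n : Set (Matrix (Fin n) (Fin n) ℚ_[p])ˣ) :=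
  Submonoid.units_isCompact isCompact_setOf_forall_norm_le_one

theorem det_map_coe (M : Matrix (Fin n) (Fin n) ℤ_[p]) :
    (M.map ((↑) : ℤ_[p] → ℚ_[p])).det = M.det :=
  (RingHom.map_det (PadicInt.Coe.ringHom (p := p)) M).symm

theorem map_coe_mul (M N : Matrix (Fin n) (Fin n) ℤ_[p]) :
    (M * N).map ((↑) : ℤ_[p] → ℚ_[p]) = M.map (↑) * N.map (↑) :=
  Matrix.map_mul (f := PadicInt.Coe.ringHom (p := p))

theorem map_coe_injective :
    Function.Injective fun M : Matrix (Fin n) (Fin n) ℤ_[p] => M.map ((↑) : ℤ_[p] → ℚ_[p]) :=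
  Matrix.map_injective Subtype.coe_injective

theorem exists_map_coe_eq {M : Matrix (Fin n) (Fin n) ℚ_[p]} (hM : ∀ i j, ‖M i j‖ ≤ 1) :
    ∃ N : Matrix (Fin n) (Fin n) ℤ_[p], N.map (↑) = M :=
  ⟨of fun i j => ⟨M i j, hM i j⟩, rfl⟩

theorem mem_integralUnits_iff_exists {g : (Matrix (Fin n) (Fin n) ℚ_[p])ˣ} :
    g ∈ integralUnits p n ↔
      ∃ k : Matrix (Fin n) (Fin n) ℤ_[p], IsUnit k.det ∧ k.map (↑) = (g : Matrix _ _ ℚ_[p]) := by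
  have map_one : (1 : Matrix (Fin n) (Fin n) ℤ_[p]).map ((↑) : ℤ_[p] → ℚ_[p]) = 1 :=
    Matrix.map_one _ rfl rfl
  constructor
  · intro h
    obtain ⟨h1, h2⟩ := mem_integralUnits_iff.1 h
    obtain ⟨k, hk⟩ := exists_map_coe_eq h1
    obtain ⟨l, hl⟩ := exists_map_coe_eq h2
    refine ⟨k, isUnit_det_of_right_inverse (B := l) (map_coe_injective ?_), hk⟩
    simp only [map_coe_mul, hk, hl, map_one, Units.mul_inv]
  · rintro ⟨k, hk, h⟩
    have h' : (k⁻¹).map (↑) = ((g⁻¹ : (Matrix (Fin n) (Fin n) ℚ_[p])ˣ) : Matrix _ _ ℚ_[p]) := by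
      refine (Units.inv_eq_of_mul_eq_one_right ?_).symm
      rw [← h, ← map_coe_mul, mul_nonsing_inv _ hk, map_one]
    refine mem_integralUnits_iff.2 ⟨fun i j => ?_, fun i j => ?_⟩
    · rw [← h]; exact (k i j).2
    · rw [← h']; exact (k⁻¹ i j).2

/-- The invertible matrix over `ℚ_[p]` attached to a nonsingular matrix over `ℤ_[p]`. -/
noncomputable def unitOfDetNeZero (M : Matrix (Fin n) (Fin n) ℤ_[p]) (hM : M.det ≠ 0) :
    (Matrix (Fin n) (Fin n) ℚ_[p])ˣ :=
  nonsingInvUnit (M.map (↑)) (by rw [det_map_coe]; simpa using hM)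

theorem coe_unitOfDetNeZero (M : Matrix (Fin n) (Fin n) ℤ_[p]) (hM : M.det ≠ 0) :
    (unitOfDetNeZero M hM : Matrix (Fin n) (Fin n) ℚ_[p]) = M.map (↑) := rfl

namespace HermiteSystem

variable (H : HermiteSystem p (Fin n))

theorem det_rep_ne_zero (x : H.Index) : (H.rep x).det ≠ 0 := by
  rw [H.det_rep]
  exact pow_ne_zero _ (Nat.cast_ne_zero.2 hp.out.ne_zero)

/-- The left coset of `GL_n(ℤ_p)` represented by `H.rep x`. -/
def coset (x : H.Index) : Set (Matrix (Fin n) (Fin n) ℚ_[p])ˣ :=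
  {g | ∃ k : Matrix (Fin n) (Fin n) ℤ_[p], IsUnit k.det ∧
    (H.rep x * k).map (↑) = (g : Matrix _ _ ℚ_[p])}

theorem coset_eq_smul (x : H.Index) :
    H.coset x = unitOfDetNeZero (H.rep x) (H.det_rep_ne_zero x) •
      (integralUnits p n : Set (Matrix (Fin n) (Fin n) ℚ_[p])ˣ) := by
  ext g
  rw [Set.mem_smul_set_iff_inv_smul_mem, SetLike.mem_coe, mem_integralUnits_iff_exists]
  refine exists_congr fun k => and_congr_right fun _ => ?_
  rw [map_coe_mul, ← coe_unitOfDetNeZero _ (H.det_rep_ne_zero x), smul_eq_mul, Units.val_mul,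
    Units.eq_inv_mul_iff_mul_eq]

theorem iUnion_coset : ⋃ x, H.coset x =
    {g : (Matrix (Fin n) (Fin n) ℚ_[p])ˣ |
      ∀ i j, ‖(g : Matrix (Fin n) (Fin n) ℚ_[p]) i j‖ ≤ 1} := by
  ext g
  simp only [Set.mem_iUnion, Set.mem_ofPred_eq]
  constructor
  · rintro ⟨x, k, -, h⟩ i j
    rw [← h]
    exact ((H.rep x * k) i j).2
  · intro h
    obtain ⟨M, hM⟩ := exists_map_coe_eq h
    have hdet : M.det ≠ 0 := fun h0 => by
      have := (isUnit_iff_isUnit_det _).1 g.isUnit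
      rw [← hM, det_map_coe, h0] at this
      simp at this
    obtain ⟨x, k, hk, rfl⟩ := H.exists_eq_mul M hdet
    exact ⟨x, k, hk, hM⟩

theorem pairwise_disjoint_coset : Pairwise (Function.onFun Disjoint H.coset) := by
  intro x y hxy
  refine Set.disjoint_left.2 ?_
  rintro g ⟨k, hk, h⟩ ⟨l, hl, h'⟩
  have h2 : H.rep x * k = H.rep y * l := map_coe_injective (h.trans h'.symm)
  refine hxy (H.index_eq x y (l * k⁻¹) ?_ ?_)
  · rw [det_mul]
    exact hl.mul (isUnit_nonsing_inv_det _ hk)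
  · rw [← mul_assoc, ← h2, mul_nonsing_inv_cancel_right _ _ hk]

theorem norm_det_of_mem_coset {x : H.Index} {g : (Matrix (Fin n) (Fin n) ℚ_[p])ˣ}
    (hg : g ∈ H.coset x) :
    ‖(g : Matrix (Fin n) (Fin n) ℚ_[p]).det‖ = ((p : ℝ) ^ H.exponent x)⁻¹ := by
  obtain ⟨k, hk, h⟩ := hg
  rw [← h, det_map_coe, PadicInt.padic_norm_e_of_padicInt, det_mul, norm_mul, H.det_rep,
    PadicInt.isUnit_iff.1 hk, PadicInt.norm_p_pow, mul_one, _root_.zpow_neg, zpow_natCast]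

variable [MeasurableSpace (Matrix (Fin n) (Fin n) ℚ_[p])ˣ]

theorem measurableSet_coset [BorelSpace (Matrix (Fin n) (Fin n) ℚ_[p])ˣ] (x : H.Index) :
    MeasurableSet (H.coset x) := by
  rw [coset_eq_smul]
  exact (isOpen_integralUnits.smul _).measurableSet

theorem measure_coset (μ : Measure (Matrix (Fin n) (Fin n) ℚ_[p])ˣ) [μ.IsHaarMeasure]
    (x : H.Index) : μ (H.coset x) = μ (integralUnits p n) := by
  rw [coset_eq_smul, measure_smul]

end HermiteSystem

end Measure

/-- there is a constant `c > 0` (depending only on `n`, `p` and the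
Haar measure `μ` on `GL_n(ℚ_p)`) such that for all `s ∈ ℂ` with `Re(s) > n − 1`, the
function `g ↦ 1_{M_n(ℤ_p)}(g)·|det g|_p^s` (with `|det g|_p^s = exp(s·log|det g|_p)`)
is `μ`-integrable and its integral equals `c · ∏_{k=0}^{n−1} (1 − p^{−(s−k)})⁻¹`. -/
theorem stmt_19 (p : ℕ) [Fact p.Prime] (n : ℕ) (hn : 1 ≤ n)
    [MeasurableSpace (Matrix (Fin n) (Fin n) ℚ_[p])ˣ]
    [BorelSpace (Matrix (Fin n) (Fin n) ℚ_[p])ˣ]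
    (μ : Measure (Matrix (Fin n) (Fin n) ℚ_[p])ˣ) [μ.IsHaarMeasure] :
    ∃ c : ℝ, 0 < c ∧ ∀ s : ℂ, (n : ℝ) - 1 < s.re →
      Integrable
        (Set.indicator
          {g : (Matrix (Fin n) (Fin n) ℚ_[p])ˣ |
            ∀ i j, ‖(g : Matrix (Fin n) (Fin n) ℚ_[p]) i j‖ ≤ 1}
          (fun g =>
            Complex.exp (s * Real.log ‖(g : Matrix (Fin n) (Fin n) ℚ_[p]).det‖))) μ ∧
      ∫ g : (Matrix (Fin n) (Fin n) ℚ_[p])ˣ,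
          Set.indicator
            {g : (Matrix (Fin n) (Fin n) ℚ_[p])ˣ |
              ∀ i j, ‖(g : Matrix (Fin n) (Fin n) ℚ_[p]) i j‖ ≤ 1}
            (fun g =>
              Complex.exp (s * Real.log ‖(g : Matrix (Fin n) (Fin n) ℚ_[p]).det‖)) g ∂μ
        = (c : ℂ) * ∏ k ∈ Finset.range n,
            (1 - (p : ℂ) ^ (-(s - (k : ℂ))))⁻¹ := by
  let H := HermiteSystem.ofFin p n
  have := H.countable
  have hp : (0 : ℝ) < p := Nat.cast_pos.2 (Fact.out : p.Prime).pos
  have hp1 : (1 : ℝ) < p := Nat.one_lt_cast.2 (Fact.out : p.Prime).one_lt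
  have hpC : (p : ℂ) ≠ 0 := by exact_mod_cast hp.ne'
  have hfin : μ (integralUnits p n) ≠ ⊤ := isCompact_integralUnits.measure_lt_top.ne
  refine ⟨μ.real (integralUnits p n), ENNReal.toReal_pos
    (isOpen_integralUnits.measure_pos μ ⟨1, one_mem _⟩).ne' hfin, fun s hs => ?_⟩
  set X : ℂ := (p : ℂ) ^ (-s) with hXdef
  have hXnorm : ‖X‖ * (p : ℝ) ^ Fintype.card (Fin n) < p := by
    rw [hXdef, Complex.norm_natCast_cpow_of_pos (Fact.out : p.Prime).pos, Fintype.card_fin,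
      ← Real.rpow_natCast, ← Real.rpow_add hp]
    conv_rhs => rw [← Real.rpow_one (p : ℝ)]
    exact Real.rpow_lt_rpow_of_exponent_lt hp1 (by rw [Complex.neg_re]; linarith)
  have hsum := H.hasSum X hXnorm
  set f : (Matrix (Fin n) (Fin n) ℚ_[p])ˣ → ℂ := fun g =>
    Complex.exp (s * Real.log ‖(g : Matrix (Fin n) (Fin n) ℚ_[p]).det‖)
  have hf : ∀ x, Set.EqOn f (fun _ => X ^ H.exponent x) (H.coset x) := fun x g hg => by
    simp only [f, H.norm_det_of_mem_coset hg, Real.log_inv, Real.log_pow, hXdef]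
    rw [Complex.cpow_def_of_ne_zero hpC, ← Complex.exp_nat_mul, ← Complex.natCast_log]
    congr 1
    push_cast
    ring
  have hreal : ∀ x, μ.real (H.coset x) = μ.real (integralUnits p n) := fun x =>
    congrArg ENNReal.toReal (H.measure_coset μ x)
  have hint : ∀ x, IntegrableOn f (H.coset x) μ := fun x =>
    (integrableOn_congr_fun (hf x) (H.measurableSet_coset x)).2
      (integrableOn_const (by rw [H.measure_coset]; exact hfin))
  have hval : ∀ x, ∫ g in H.coset x, f g ∂μ = μ.real (integralUnits p n) * X ^ H.exponent x :=
    fun x => by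
      rw [setIntegral_congr_fun (H.measurableSet_coset x) (hf x), setIntegral_const, hreal,
        Complex.real_smul]
  have hnorm : ∀ x, ∫ g in H.coset x, ‖f g‖ ∂μ =
      μ.real (integralUnits p n) * ‖X ^ H.exponent x‖ := fun x => by
    rw [setIntegral_congr_fun (g := fun _ => ‖X ^ H.exponent x‖) (H.measurableSet_coset x)
      fun g hg => congrArg norm (hf x hg), setIntegral_const, hreal, smul_eq_mul]
  have hintU : IntegrableOn f (⋃ x, H.coset x) μ :=
    integrableOn_iUnion_of_summable_integral_norm hint <| by
      simp only [hnorm]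
      exact hsum.summable.norm.mul_left _
  have hmeas : MeasurableSet (⋃ x, H.coset x) := MeasurableSet.iUnion H.measurableSet_coset
  rw [← H.iUnion_coset]
  refine ⟨hintU.integrable_indicator hmeas, ?_⟩
  rw [integral_indicator hmeas]
  have h1 := hasSum_integral_iUnion H.measurableSet_coset H.pairwise_disjoint_coset hintU
  simp only [hval] at h1
  rw [h1.unique (hsum.mul_left _), Fintype.card_fin]
  congr 1
  refine Finset.prod_congr rfl fun k _ => ?_
  rw [neg_sub, sub_eq_add_neg (k : ℂ), Complex.cpow_add _ _ hpC, Complex.cpow_natCast]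
end
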